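/- Let F be a field, κ ≥ 1, n ≥ 1, and set ℓ := 2⌈log₂ κ⌉ + 1. Let K := F(t₁,…,t_n) be the field of rational functions over F. Let X₁,…,X_ℓ be pairwise disjoint subsets of {1,…,n}, and for each i ∈ {1,…,ℓ} let f_i be a polynomial in x₁,…,x_n with coefficients in H_κ(F) whose variables all lie in {x_j : j ∈ X_i}, such that every coordinate of f_i is a nonzero polynomial in F[x₁,…,x_n]. Regarding f_i as a polynomial over H_κ(K), its evaluation f_i(t) under x_j ↦ t_j is a unit of H_κ(K); define the shifted-and-normalized polynomial f'_i(x) := f_i(t)^{−1} ⋆ f_i(x₁+t₁,…,x_n+t_n) over H_κ(K), and let D' := f'_1 ⋆ ⋯ ⋆ f'_ℓ (the product in the polynomial ring over H_κ(K)). For e ∈ ℕⁿ define the block-support bs(e) := #{i ∈ {1,…,ℓ} : S(e) ∩ X_i ≠ ∅}. Then every coefficient of D' lies in the K-linear span of {Coef(e)(D') : e ∈ ℕⁿ, bs(e) < ℓ}. -/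

import Mathlib

noncomputable section

open MvPolynomial

/-- The canonical embedding of `F[t₁,…,t_n]` into the rational function field
`K = F(t₁,…,t_n)`. -/
def iK (F : Type*) [Field F] (n : ℕ) :
    MvPolynomial (Fin n) F →+* FractionRing (MvPolynomial (Fin n) F) :=
  algebraMap _ _

/-- For `f` a polynomial over the Hadamard algebra `H_κ(F)`, the element
`f(t) ∈ H_κ(K)` obtained by the substitution `x_j ↦ t_j`. -/
def hadamardEvalT (F : Type*) [Field F] (κ n : ℕ)
    (f : MvPolynomial (Fin n) (Fin κ → F)) :
    Fin κ → FractionRing (MvPolynomial (Fin n) F) :=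
  fun c => iK F n (MvPolynomial.map (Pi.evalRingHom (fun _ => F) c) f)

/-- The coordinatewise embedding `H_κ(F) →+* H_κ(K)`. -/
def hadamardEmbed (F : Type*) [Field F] (κ n : ℕ) :
    (Fin κ → F) →+* (Fin κ → FractionRing (MvPolynomial (Fin n) F)) :=
  Pi.ringHom fun c => ((iK F n).comp MvPolynomial.C).comp (Pi.evalRingHom (fun _ => F) c)

/-- The shifted polynomial `f(x+t)`, a polynomial in `x₁,…,x_n` over `H_κ(K)`. -/
def shiftPoly (F : Type*) [Field F] (κ n : ℕ)
    (f : MvPolynomial (Fin n) (Fin κ → F)) :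
    MvPolynomial (Fin n) (Fin κ → FractionRing (MvPolynomial (Fin n) F)) :=
  MvPolynomial.eval₂ (MvPolynomial.C.comp (hadamardEmbed F κ n))
    (fun j => MvPolynomial.X j + MvPolynomial.C (fun _ => iK F n (MvPolynomial.X j))) f

/-- The shifted-and-normalized polynomial `f'(x) = f(t)⁻¹ ⋆ f(x+t)` over `H_κ(K)`. -/
def shiftNormalize (F : Type*) [Field F] (κ n : ℕ)
    (f : MvPolynomial (Fin n) (Fin κ → F)) :
    MvPolynomial (Fin n) (Fin κ → FractionRing (MvPolynomial (Fin n) F)) :=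
  MvPolynomial.C (fun c => (hadamardEvalT F κ n f c)⁻¹) * shiftPoly F κ n f


/-- Triangular pivots in the support of a matrix indexed by exponent vectors. -/
theorem exists_triangular_pivots {σ ι : Type*} [LinearOrder σ] [Finite σ] [DecidableEq ι]
    (X : ι → Finset σ) (hX : ∀ i j, i ≠ j → Disjoint (X i) (X j)) (B : Finset ι) :
    ∀ S : Finset ((σ →₀ ℕ) × (σ →₀ ℕ)), S.Nonempty →
      (∀ i ∈ B, ∀ p ∈ S, ∃ q ∈ S, q ≠ p ∧ (∀ j ∉ X i, q.2 j = p.2 j) ∧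
        q.1 + q.2 = p.1 + p.2) →
      ∃ (I : Type) (_ : Fintype I) (_ : LinearOrder I) (d e : I → σ →₀ ℕ),
        Fintype.card I = 2 ^ B.card ∧ (∀ i, (d i, e i) ∈ S) ∧
        ∀ i j, i < j → (d i, e j) ∉ S := by
  classical
  induction B using Finset.induction_on with
  | empty =>
    rintro S ⟨p, hp⟩ -
    exact ⟨Unit, inferInstance, inferInstance, fun _ => p.1, fun _ => p.2, by simp,
      fun _ => hp, fun i j h => absurd h (by simp)⟩
  | insert k B hk ih =>
    intro S hS h
    let r : (σ →₀ ℕ) → Lex (σ →₀ ℕ) := fun d => toLex (d.filter (· ∈ X k))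
    have r_add (d e) : r (d + e) = r d + r e := by
      simp only [r, Finsupp.filter_add]; rfl
    have r_congr {d e : σ →₀ ℕ} (hde : ∀ j ∈ X k, d j = e j) : r d = r e := by
      simp only [r]
      congr 1
      ext j
      by_cases hj : j ∈ X k <;> simp [hj, hde]
    have restrict (a b : Lex (σ →₀ ℕ)) (hne : ∃ p ∈ S, r p.1 = a ∧ r p.2 = b) :
        ∃ (I : Type) (_ : Fintype I) (_ : LinearOrder I) (d e : I → σ →₀ ℕ),
          Fintype.card I = 2 ^ B.card ∧ (∀ i, (d i, e i) ∈ S) ∧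
          (∀ i j, i < j → (d i, e j) ∉ S) ∧ (∀ i, r (d i) = a) ∧ ∀ i, r (e i) = b := by
      obtain ⟨I, hI, hI', d, e, hc, hd, ht⟩ := ih (S.filter fun p => r p.1 = a ∧ r p.2 = b)
        (by obtain ⟨p, hp, hp'⟩ := hne; exact ⟨p, by simp [hp, hp']⟩) (by
          intro i hi p hp
          rw [Finset.mem_filter] at hp
          obtain ⟨q, hq, hqp, hq2, hqs⟩ := h i (Finset.mem_insert_of_mem hi) p hp.1
          have hik : Disjoint (X i) (X k) := hX i k (by rintro rfl; exact hk hi)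
          have h2 : r q.2 = r p.2 :=
            r_congr fun j hj => hq2 j fun hj' => Finset.disjoint_left.1 hik hj' hj
          have h1 : r q.1 = r p.1 := by
            have := congrArg r hqs
            rw [r_add, r_add, h2] at this
            exact add_right_cancel this
          exact ⟨q, by simp [hq, h1, h2, hp.2], hqp, hq2, hqs⟩)
      simp only [Finset.mem_filter] at hd ht
      exact ⟨I, hI, hI', d, e, hc, fun i => (hd i).1,
        fun i j hij hS' => ht i j hij ⟨hS', (hd i).2.1, (hd j).2.2⟩,
        fun i => (hd i).2.1, fun i => (hd i).2.2⟩
    obtain ⟨p₁, hp₁, hmax₁⟩ := S.exists_max_image (fun p => r p.1) hS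
    obtain ⟨p₀, hp₀, hmax₀⟩ := (S.filter fun p => r p.1 = r p₁.1).exists_max_image
      (fun p => r p.2) ⟨p₁, by simp [hp₁]⟩
    rw [Finset.mem_filter] at hp₀
    obtain ⟨q, hq, hqp, hq2, hqs⟩ := h k (Finset.mem_insert_self _ _) p₀ hp₀.1
    have hrs : r q.1 + r q.2 = r p₀.1 + r p₀.2 := by rw [← r_add, ← r_add, hqs]
    have hlt : r q.1 < r p₀.1 := by
      refine lt_of_le_of_ne (hp₀.2 ▸ hmax₁ q hq) fun heq => hqp ?_
      rw [heq] at hrs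
      have heq2 : q.2 = p₀.2 := by
        ext j
        by_cases hj : j ∈ X k
        · have := DFunLike.congr_fun (toLex.injective (add_left_cancel hrs)) j
          simpa [hj] using this
        · exact hq2 j hj
      rw [heq2] at hqs
      exact Prod.ext (add_right_cancel hqs) heq2
    have hgt : r p₀.2 < r q.2 := by
      by_contra! hle
      exact absurd hrs (add_lt_add_of_lt_of_le hlt hle).ne
    obtain ⟨I, _, _, d, e, hc, hd, ht, hda, -⟩ := restrict _ _ ⟨p₀, hp₀.1, rfl, rfl⟩
    obtain ⟨J, _, _, d', e', hc', hd', ht', -, heb⟩ := restrict _ _ ⟨q, hq, rfl, rfl⟩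
    refine ⟨I ⊕ₗ J, inferInstanceAs (Fintype (I ⊕ J)), inferInstance,
      fun x => Sum.elim d d' (ofLex x), fun x => Sum.elim e e' (ofLex x), ?_, ?_, ?_⟩
    · rw [Finset.card_insert_of_notMem hk, pow_succ, mul_two]
      exact (Fintype.card_sum (α := I) (β := J)).trans (by rw [hc, hc'])
    · rintro (i | j)
      exacts [hd i, hd' j]
    · rintro (i | i) (j | j) hij
      · exact ht i j (Sum.Lex.inl_lt_inl_iff.1 hij)
      · intro hmem
        have hle := hmax₀ (d i, e' j) (by
          rw [Finset.mem_filter]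
          exact ⟨hmem, (hda i).trans hp₀.2⟩)
        exact absurd ((heb j).symm.trans_le hle) hgt.not_ge
      · exact absurd hij Sum.Lex.not_inr_lt_inl
      · exact ht' i j (Sum.Lex.inr_lt_inr_iff.1 hij)

theorem card_le_of_triangular_factorization {F I E E' γ : Type*} [Field F] [Fintype I]
    [LinearOrder I] [Fintype γ] (u : γ → E → F) (v : γ → E' → F) (d : I → E) (e : I → E')
    (hdiag : ∀ i, ∑ c, u c (d i) * v c (e i) ≠ 0)
    (htri : ∀ i j, i < j → ∑ c, u c (d i) * v c (e j) = 0) :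
    Fintype.card I ≤ Fintype.card γ := by
  classical
  let U : Matrix I γ F := .of fun i c => u c (d i)
  let V : Matrix γ I F := .of fun c j => v c (e j)
  have hdet : IsUnit (U * V).det := by
    rw [Matrix.det_of_isLowerTriangular (U * V) fun i j hij => htri i j hij]
    exact (Finset.prod_ne_zero_iff.2 fun i _ => hdiag i).isUnit
  calc Fintype.card I = (U * V).rank :=
        (Matrix.rank_of_isUnit _ ((Matrix.isUnit_iff_isUnit_det _).2 hdet)).symm
    _ ≤ U.rank := Matrix.rank_mul_le_left U V
    _ ≤ Fintype.card γ := Matrix.rank_le_card_width U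

/-- The substitution `x_j ↦ t_j` for `j ∈ X` on `F[t][x]`. -/
def identifyBlock {R σ : Type*} [CommRing R] [DecidableEq σ] (X : Finset σ) :
    MvPolynomial σ (MvPolynomial σ R) →ₐ[MvPolynomial σ R] MvPolynomial σ (MvPolynomial σ R) :=
  aeval fun j => if j ∈ X then C (MvPolynomial.X j) else MvPolynomial.X j

theorem identifyBlock_monomial {R σ : Type*} [CommRing R] [DecidableEq σ] (X : Finset σ)
    (e : σ →₀ ℕ) (p : MvPolynomial σ R) :
    identifyBlock X (monomial e p) =
      monomial (e.filter (· ∉ X)) (p * monomial (e.filter (· ∈ X)) 1) := by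
  conv_lhs => rw [← Finsupp.filter_add_filter_not e (· ∈ X)]
  rw [← mul_one p, ← mul_one (p * 1), ← monomial_mul, map_mul, mul_one, mul_one]
  have h1 : identifyBlock X (monomial (e.filter (· ∈ X)) p) =
      C (p * monomial (e.filter (· ∈ X)) 1) := by
    rw [identifyBlock, aeval_monomial, map_mul, monomial_eq, map_mul, map_one, map_one, one_mul,
      Finsupp.prod, Finsupp.prod, map_prod, algebraMap_eq]
    congr 1
    refine Finset.prod_congr rfl fun j hj => ?_
    have : j ∈ X := by simp at hj; exact hj.2
    simp [this]
  have h2 : identifyBlock X (monomial (e.filter (· ∉ X)) (1 : MvPolynomial σ R)) =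
      monomial (e.filter (· ∉ X)) 1 := by
    rw [identifyBlock, aeval_monomial, monomial_eq, Finsupp.prod, Finsupp.prod, algebraMap_eq]
    congr 1
    refine Finset.prod_congr rfl fun j hj => ?_
    have : j ∉ X := by simp at hj; exact hj.2
    simp [this]
  rw [h1, h2, C_mul_monomial, mul_one]

theorem exists_ne_of_identifyBlock_eq_zero {R σ : Type*} [CommRing R] [DecidableEq σ]
    {X : Finset σ} {Q : MvPolynomial σ (MvPolynomial σ R)} (hQ : identifyBlock X Q = 0)
    {d e : σ →₀ ℕ} (h : coeff d (coeff e Q) ≠ 0) :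
    ∃ d' e', coeff d' (coeff e' Q) ≠ 0 ∧ e' ≠ e ∧ (∀ j ∉ X, e' j = e j) ∧ d' + e' = d + e := by
  by_contra! hno
  rw [Q.as_sum, map_sum] at hQ
  have h0 := congrArg (fun P => coeff (d + e.filter (· ∈ X)) (coeff (e.filter (· ∉ X)) P)) hQ
  simp only [identifyBlock_monomial, coeff_sum, coeff_zero] at h0
  rw [Finset.sum_eq_single e] at h0
  · simp [coeff_mul_monomial] at h0
    exact h h0
  · intro e' _ hne
    rw [coeff_monomial]
    split_ifs with hf
    · rw [coeff_mul_monomial', mul_one]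
      split_ifs with hle
      · by_contra hne0
        have hoff (j) (hj : j ∉ X) : e' j = e j := by
          simpa [hj] using DFunLike.congr_fun hf j
        refine hno _ e' hne0 hne hoff ?_
        ext j
        have hj := hle j
        by_cases hjX : j ∈ X
        · simp [hjX] at hj ⊢
          omega
        · simp [hjX, hoff j hjX]
      · rfl
    · simp
  · intro he
    rw [notMem_support_iff] at he
    simp [he]

/-- The generic shift `x_j ↦ x_j + t_j`, as a ring homomorphism `F[t][x] → K[x]`. -/
def genericShift (F : Type*) [Field F] (n : ℕ) :
    MvPolynomial (Fin n) (MvPolynomial (Fin n) F) →+*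
      MvPolynomial (Fin n) (FractionRing (MvPolynomial (Fin n) F)) :=
  eval₂Hom (C.comp (iK F n)) fun j => X j + C (iK F n (X j))

theorem genericShift_injective (F : Type*) [Field F] (n : ℕ) :
    Function.Injective (genericShift F n) := by
  have hcomp : (eval₂Hom C fun j => X j - C (iK F n (X j))).comp (genericShift F n) =
      MvPolynomial.map (iK F n) := by
    refine ringHom_ext (fun p => ?_) fun j => ?_ <;> simp [genericShift]
  refine Function.Injective.of_comp (f := eval₂Hom C fun j => X j - C (iK F n (X j))) ?_
  rw [← RingHom.coe_comp, hcomp]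
  exact map_injective _ (IsFractionRing.injective _ _)

theorem genericShift_identifyBlock {F : Type*} [Field F] {n : ℕ} (Y : Finset (Fin n))
    (Q : MvPolynomial (Fin n) (MvPolynomial (Fin n) F)) :
    genericShift F n (identifyBlock Y Q) =
      aeval (fun j => if j ∈ Y then 0 else X j) (genericShift F n Q) := by
  suffices hcomp : (genericShift F n).comp (identifyBlock Y).toRingHom =
      (AlgHom.toRingHom (aeval fun j => if j ∈ Y then 0 else X j)).comp (genericShift F n) from
    DFunLike.congr_fun hcomp Q
  refine ringHom_ext (fun p => ?_) fun j => ?_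
  · simp [genericShift, identifyBlock, algebraMap_eq]
  · by_cases hj : j ∈ Y <;> simp [genericShift, identifyBlock, algebraMap_eq, hj]

theorem aeval_ite_zero_eq_zero {R σ : Type*} [CommRing R] [DecidableEq σ] (Y : Finset σ)
    {P : MvPolynomial σ R} (hP : ∀ e : σ →₀ ℕ, Disjoint e.support Y → coeff e P = 0) :
    aeval (fun j => if j ∈ Y then (0 : MvPolynomial σ R) else X j) P = 0 := by
  rw [P.as_sum, map_sum]
  refine Finset.sum_eq_zero fun e he => ?_
  obtain ⟨j, hj, hjY⟩ := Finset.not_disjoint_iff.1 fun hd => mem_support_iff.1 he (hP e hd)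
  rw [aeval_monomial, Finsupp.prod, Finset.prod_eq_zero hj, mul_zero]
  simp [hjY, Finsupp.mem_support_iff.1 hj]

/-- Over `F(t)`, a nonzero combination of fewer than `2 ^ ℓ` generic shifts of polynomials
over `F` has a nonzero coefficient at an exponent avoiding one of `ℓ` disjoint blocks. -/
theorem sum_genericShift_eq_zero {F : Type*} [Field F] {κ n ℓ : ℕ} (hκ : κ < 2 ^ ℓ)
    (Y : Fin ℓ → Finset (Fin n)) (hY : ∀ i j, i ≠ j → Disjoint (Y i) (Y j))
    (μ : Fin κ → FractionRing (MvPolynomial (Fin n) F)) (G : Fin κ → MvPolynomial (Fin n) F)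
    (hP : ∀ i, ∀ e : Fin n →₀ ℕ, Disjoint e.support (Y i) →
      coeff e (∑ c, C (μ c) * genericShift F n (MvPolynomial.map C (G c))) = 0) :
    ∑ c, C (μ c) * genericShift F n (MvPolynomial.map C (G c)) = 0 := by
  classical
  obtain ⟨⟨b, hb⟩, hint⟩ := IsLocalization.exist_integer_multiples_of_finite
    (nonZeroDivisors (MvPolynomial (Fin n) F)) μ
  choose a ha using hint
  have hb0 : iK F n b ≠ 0 := by
    simpa [iK] using nonZeroDivisors.ne_zero hb
  set P := ∑ c, C (μ c) * genericShift F n (MvPolynomial.map C (G c)) with hPdef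
  let Q : MvPolynomial (Fin n) (MvPolynomial (Fin n) F) :=
    ∑ c, C (a c) * MvPolynomial.map C (G c)
  have hQP : genericShift F n Q = C (iK F n b) * P := by
    simp only [Q, hPdef, map_sum, map_mul, Finset.mul_sum, ← mul_assoc]
    refine Finset.sum_congr rfl fun c _ => ?_
    congr 1
    rw [← C_mul]
    simp only [genericShift, coe_eval₂Hom, eval₂_C, RingHom.comp_apply]
    congr 1
    rw [iK, ha, Algebra.smul_def]
  suffices hQ : Q = 0 by
    rw [hQ, map_zero, eq_comm, mul_eq_zero] at hQP
    exact hQP.resolve_left (by simpa using hb0)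
  have hid (i) : identifyBlock (Y i) Q = 0 := by
    apply genericShift_injective F n
    rw [genericShift_identifyBlock, hQP, map_mul, aeval_ite_zero_eq_zero (Y i) (hP i), mul_zero,
      map_zero]
  have hcoeff (d e) : coeff d (coeff e Q) = ∑ c, coeff d (a c) * coeff e (G c) := by
    simp only [Q, coeff_sum, coeff_C_mul, coeff_map, mul_comm (a _)]
    simp [mul_comm]
  by_contra hQ
  let S : Finset ((Fin n →₀ ℕ) × (Fin n →₀ ℕ)) :=
    Q.support.biUnion fun e => (coeff e Q).support.image fun d => (d, e)
  have hS (d e) : (d, e) ∈ S ↔ coeff d (coeff e Q) ≠ 0 := by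
    simp only [S, Finset.mem_biUnion, Finset.mem_image, Prod.mk.injEq, mem_support_iff]
    constructor
    · rintro ⟨_, _, _, h, rfl, rfl⟩
      exact h
    · exact fun h => ⟨e, fun h0 => h (by simp [h0]), d, h, rfl, rfl⟩
  have hSne : S.Nonempty := by
    obtain ⟨e, he⟩ := ne_zero_iff.1 hQ
    obtain ⟨d, hd⟩ := ne_zero_iff.1 he
    exact ⟨(d, e), (hS d e).2 hd⟩
  obtain ⟨I, _, _, d, e, hI, hdiag, htri⟩ := exists_triangular_pivots Y hY Finset.univ S hSne (by
    rintro i - ⟨d, e⟩ hp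
    obtain ⟨d', e', h, hne, hoff, hsum⟩ :=
      exists_ne_of_identifyBlock_eq_zero (hid i) ((hS d e).1 hp)
    exact ⟨(d', e'), (hS d' e').2 h, fun h' => hne (congrArg Prod.snd h'), hoff, hsum⟩)
  have hle := card_le_of_triangular_factorization (fun c d => coeff d (a c))
    (fun c e => coeff e (G c)) d e (fun i => by rw [← hcoeff]; exact (hS _ _).1 (hdiag i))
    (fun i j hij => by
      rw [← hcoeff]
      by_contra h0
      exact htri i j hij ((hS _ _).2 h0))
  rw [hI, Finset.card_univ, Fintype.card_fin, Fintype.card_fin] at hle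
  omega

theorem map_shiftNormalize {F : Type*} [Field F] {κ n : ℕ}
    (f : MvPolynomial (Fin n) (Fin κ → F)) (c : Fin κ) :
    MvPolynomial.map (Pi.evalRingHom _ c) (shiftNormalize F κ n f) =
      C (hadamardEvalT F κ n f c)⁻¹ * genericShift F n
        (MvPolynomial.map C (MvPolynomial.map (Pi.evalRingHom (fun _ => F) c) f)) := by
  have hcomp : (MvPolynomial.map (Pi.evalRingHom _ c)).comp
      (eval₂Hom (C.comp (hadamardEmbed F κ n)) fun j => X j + C fun _ => iK F n (X j)) =
      (genericShift F n).comp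
        ((MvPolynomial.map C).comp (MvPolynomial.map (Pi.evalRingHom (fun _ => F) c))) := by
    refine ringHom_ext (fun p => ?_) fun j => ?_
    · simp only [RingHom.comp_apply, coe_eval₂Hom, eval₂_C, map_C, genericShift]
      rfl
    · simp [genericShift]
  rw [shiftNormalize, map_mul, map_C]
  exact congrArg _ (DFunLike.congr_fun hcomp f)

/-- **Low block-support rank concentration.**  Let `ℓ = 2⌈log₂ κ⌉ + 1`, let
`X₁,…,X_ℓ` be pairwise disjoint variable sets and `fᵢ` polynomials over `H_κ(F)`
with variables in `Xᵢ` and all coordinates nonzero.  With `f'ᵢ` the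
shifted-and-normalized polynomials over `K = F(t₁,…,t_n)` and `D' = f'₁ ⋆ ⋯ ⋆ f'_ℓ`,
every coefficient of `D'` lies in the `K`-span of the coefficients of `D'` at
exponents of block-support less than `ℓ`. -/
theorem low_block_support_concentration {F : Type*} [Field F] (κ n : ℕ)
    (hκ : 1 ≤ κ) (hn : 1 ≤ n) (ℓ : ℕ) (hℓ : ℓ = 2 * Nat.clog 2 κ + 1)
    (X : Fin ℓ → Finset (Fin n))
    (hdisj : ∀ i j : Fin ℓ, i ≠ j → Disjoint (X i) (X j))
    (f : Fin ℓ → MvPolynomial (Fin n) (Fin κ → F))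
    (hvars : ∀ i : Fin ℓ, ∀ e ∈ (f i).support, e.support ⊆ X i)
    (hcoord : ∀ i : Fin ℓ, ∀ c : Fin κ,
      MvPolynomial.map (Pi.evalRingHom (fun _ => F) c) (f i) ≠ 0) :
    ∀ e : Fin n →₀ ℕ,
      MvPolynomial.coeff e (∏ i : Fin ℓ, shiftNormalize F κ n (f i)) ∈
        Submodule.span (FractionRing (MvPolynomial (Fin n) F))
          {v | ∃ e' : Fin n →₀ ℕ,
            (Finset.univ.filter fun i : Fin ℓ => (e'.support ∩ X i).Nonempty).card < ℓ ∧
            MvPolynomial.coeff e' (∏ i : Fin ℓ, shiftNormalize F κ n (f i)) = v} := by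
  intro e
  by_contra hmem
  obtain ⟨φ, hφ, hker⟩ := Submodule.exists_le_ker_of_notMem hmem
  set D := ∏ i : Fin ℓ, shiftNormalize F κ n (f i) with hD
  let μ : Fin κ → FractionRing (MvPolynomial (Fin n) F) := fun c =>
    φ (Pi.single c 1) * ∏ i, (hadamardEvalT F κ n (f i) c)⁻¹
  let G : Fin κ → MvPolynomial (Fin n) F := fun c =>
    ∏ i, MvPolynomial.map (Pi.evalRingHom (fun _ => F) c) (f i)
  have hcoeff (e) : coeff e (∑ c, C (μ c) * genericShift F n (MvPolynomial.map C (G c))) =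
      φ (coeff e D) := by
    have hterm (c) : C (μ c) * genericShift F n (MvPolynomial.map C (G c)) =
        C (φ (Pi.single c 1)) * MvPolynomial.map (Pi.evalRingHom _ c) D := by
      simp only [hD, μ, G, map_prod, map_shiftNormalize, Finset.prod_mul_distrib, map_mul,
        mul_assoc]
    simp only [hterm, coeff_sum, coeff_C_mul, coeff_map]
    conv_rhs => rw [LinearMap.pi_apply_eq_sum_univ φ (coeff e D)]
    refine Finset.sum_congr rfl fun c _ => ?_
    rw [smul_eq_mul, mul_comm]
    congr 2
    ext c'
    simp [Pi.single_apply, eq_comm]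
  have hκℓ : κ < 2 ^ ℓ := calc
    κ ≤ 2 ^ Nat.clog 2 κ := Nat.le_pow_clog one_lt_two κ
    _ < 2 ^ ℓ := Nat.pow_lt_pow_right one_lt_two (by omega)
  refine hφ ?_
  rw [← hcoeff, sum_genericShift_eq_zero hκℓ X hdisj μ G, coeff_zero]
  intro i e' he'
  rw [hcoeff]
  refine hker (Submodule.subset_span ⟨e', ?_, rfl⟩)
  calc _ < (Finset.univ : Finset (Fin ℓ)).card := Finset.card_lt_card <| by
        rw [Finset.filter_ssubset]
        exact ⟨i, Finset.mem_univ i, by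
          rwa [Finset.not_nonempty_iff_eq_empty, ← Finset.disjoint_iff_inter_eq_empty]⟩
    _ = ℓ := by simp

end
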